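/- Assume δ ≠ 0. Let l ∈ {1,…,c} be a label and let p̲_l ∈ (0,1) satisfy p̲_l ≤ Pr(l ∈ f_{k'}(X)). Then the adversarial label probability satisfies Pr(l ∈ f_{k'}(Y)) ≥ Φ(Φ⁻¹(p̲_l) − ‖δ‖₂/σ). -/

import Mathlib

open MeasureTheory ProbabilityTheory

/-- Isotropic Gaussian measure `N(m, σ²I)` on `ℝ^d`, as a product of 1-D Gaussians. -/
noncomputable def gaussPi (d : ℕ) (m : Fin d → ℝ) (σ : ℝ) : Measure (Fin d → ℝ) :=
  Measure.pi fun i => gaussianReal (m i) ⟨σ ^ 2, sq_nonneg σ⟩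

/-- Standard Gaussian CDF `Φ`. -/
noncomputable def Phi (x : ℝ) : ℝ := (gaussianReal 0 1 (Set.Iic x)).toReal

/-- Inverse of the standard Gaussian CDF, `Φ⁻¹` (genuine inverse on `(0,1)` since `Φ` is a
strictly increasing continuous bijection from `ℝ` onto `(0,1)`). -/
noncomputable def PhiInv : ℝ → ℝ := Function.invFun Phi

/-- Euclidean dot product `aᵀb` on `ℝ^d`. -/
noncomputable def dotp (d : ℕ) (a b : Fin d → ℝ) : ℝ := ∑ i, a i * b i

/-- Euclidean norm `‖a‖₂` on `ℝ^d`. -/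
noncomputable def enorm2 (d : ℕ) (a : Fin d → ℝ) : ℝ := Real.sqrt (∑ i, a i ^ 2)

open scoped ENNReal NNReal

theorem Measure.pi_withDensity {ι : Type*} [Fintype ι] {α : ι → Type*}
    [∀ i, MeasurableSpace (α i)] (μ : ∀ i, Measure (α i)) [∀ i, IsProbabilityMeasure (μ i)]
    (g : ∀ i, α i → ℝ≥0∞) (hg : ∀ i, Measurable (g i))
    [∀ i, SigmaFinite ((μ i).withDensity (g i))] :
    Measure.pi (fun i => (μ i).withDensity (g i)) =
      (Measure.pi μ).withDensity fun w => ∏ i, g i (w i) := by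
  refine Measure.pi_eq fun s hs => ?_
  have hind : ∀ i, Measurable ((s i).indicator (g i)) := fun i => (hg i).indicator (hs i)
  have hprod : (Set.univ.pi s).indicator (fun w => ∏ i, g i (w i)) =
      fun w => ∏ i, (s i).indicator (g i) (w i) := by
    ext w
    by_cases hw : w ∈ Set.univ.pi s
    · rw [Set.indicator_of_mem hw]
      exact Finset.prod_congr rfl fun i _ => (Set.indicator_of_mem (hw i trivial) _).symm
    · rw [Set.indicator_of_notMem hw]
      simp only [Set.mem_univ_pi, not_forall] at hw
      obtain ⟨i, hi⟩ := hw
      exact (Finset.prod_eq_zero (Finset.mem_univ i) (Set.indicator_of_notMem hi _)).symm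
  have hindep : iIndepFun (fun i (w : ∀ i, α i) => (s i).indicator (g i) (w i)) (Measure.pi μ) :=
    iIndepFun_pi fun i => (hind i).aemeasurable
  rw [withDensity_apply _ (MeasurableSet.univ_pi hs), ← lintegral_indicator (MeasurableSet.univ_pi hs),
    hprod, lintegral_prod_eq_prod_lintegral_of_indepFun Finset.univ _ hindep
      fun i => (hind i).comp (measurable_pi_apply i)]
  refine Finset.prod_congr rfl fun i _ => ?_
  rw [withDensity_apply _ (hs i), ← lintegral_indicator (hs i),
    (measurePreserving_eval μ i).lintegral_comp (hind i)]

theorem gaussianReal_add_eq_withDensity (m a : ℝ) {v : ℝ≥0} (hv : v ≠ 0) :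
    gaussianReal (m + a) v = (gaussianReal m v).withDensity
      fun y => ENNReal.ofReal (Real.exp (a * (y - m) / v - a * a / (2 * v))) := by
  rw [gaussianReal_of_var_ne_zero _ hv, gaussianReal_of_var_ne_zero _ hv,
    ← withDensity_mul _ (by fun_prop) (by fun_prop)]
  congr 1
  ext y
  rw [Pi.mul_apply, gaussianPDF, gaussianPDF, ← ENNReal.ofReal_mul (gaussianPDFReal_nonneg _ _ _),
    gaussianPDFReal, gaussianPDFReal, mul_assoc _ (Real.exp _), ← Real.exp_add]
  congr 3
  have : (v : ℝ) ≠ 0 := by exact_mod_cast hv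
  field_simp
  ring

theorem gaussPi_eq_pi_toNNReal (d : ℕ) (m : Fin d → ℝ) (σ : ℝ) :
    gaussPi d m σ = Measure.pi fun i => gaussianReal (m i) (σ ^ 2).toNNReal := by
  rw [Real.toNNReal_of_nonneg (sq_nonneg σ)]
  rfl

instance isProbabilityMeasure_gaussPi (d : ℕ) (m : Fin d → ℝ) (σ : ℝ) :
    IsProbabilityMeasure (gaussPi d m σ) := by
  rw [gaussPi_eq_pi_toNNReal]
  infer_instance

theorem gaussPi_add_eq_withDensity {d : ℕ} (x δ : Fin d → ℝ) {σ : ℝ} (hσ : 0 < σ) :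
    gaussPi d (x + δ) σ = (gaussPi d x σ).withDensity fun w =>
      ENNReal.ofReal (Real.exp ((dotp d δ w - dotp d δ x) / σ ^ 2 - dotp d δ δ / (2 * σ ^ 2))) := by
  have hv : (σ ^ 2).toNNReal ≠ 0 := (Real.toNNReal_pos.2 (pow_pos hσ 2)).ne'
  have hsf : ∀ i, SigmaFinite ((gaussianReal (x i) (σ ^ 2).toNNReal).withDensity fun y =>
      ENNReal.ofReal (Real.exp (δ i * (y - x i) / (σ ^ 2).toNNReal -
        δ i * δ i / (2 * (σ ^ 2).toNNReal)))) := fun i => by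
    rw [← gaussianReal_add_eq_withDensity _ _ hv]
    infer_instance
  simp only [gaussPi_eq_pi_toNNReal, Pi.add_apply, gaussianReal_add_eq_withDensity _ _ hv]
  rw [Measure.pi_withDensity _ (fun i y => ENNReal.ofReal (Real.exp (δ i * (y - x i) /
    (σ ^ 2).toNNReal - δ i * δ i / (2 * (σ ^ 2).toNNReal)))) fun i => by fun_prop]
  congr 1
  ext w
  rw [← ENNReal.ofReal_prod_of_nonneg fun i _ => (Real.exp_pos _).le, ← Real.exp_sum]
  simp only [dotp, Real.coe_toNNReal _ (sq_nonneg σ), ← Finset.sum_sub_distrib, Finset.sum_div, mul_sub]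

theorem gaussPi_map_dotp (d : ℕ) (a m : Fin d → ℝ) (σ : ℝ) :
    (gaussPi d m σ).map (dotp d a) =
      gaussianReal (dotp d a m) ((σ * enorm2 d a) ^ 2).toNNReal := by
  have hmeas : Measurable (dotp d a) := by unfold dotp; fun_prop
  have := Measure.isProbabilityMeasure_map (μ := gaussPi d m σ) hmeas.aemeasurable
  refine Measure.ext_of_charFun (funext fun t => ?_)
  rw [charFun_apply_real, integral_map hmeas.aemeasurable (by fun_prop), charFun_gaussianReal]
  have hexp : ∀ w : Fin d → ℝ, Complex.exp (t * (dotp d a w : ℝ) * Complex.I) =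
      ∏ i, Complex.exp ((t * a i : ℝ) * w i * Complex.I) := fun w => by
    rw [← Complex.exp_sum]
    simp only [dotp, Complex.ofReal_sum, Complex.ofReal_mul, Finset.mul_sum, Finset.sum_mul,
      mul_assoc]
  simp_rw [hexp]
  rw [gaussPi_eq_pi_toNNReal, integral_fintype_prod_eq_prod
    (f := fun i (y : ℝ) => Complex.exp ((t * a i : ℝ) * y * Complex.I))]
  simp_rw [← charFun_apply_real, charFun_gaussianReal]
  rw [← Complex.exp_sum, Finset.sum_sub_distrib]
  have hvar : (((σ * enorm2 d a) ^ 2).toNNReal : ℝ) = σ ^ 2 * ∑ i, a i ^ 2 := by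
    rw [Real.coe_toNNReal _ (sq_nonneg _), mul_pow, enorm2, Real.sq_sqrt (by positivity)]
  simp only [hvar, Real.coe_toNNReal _ (sq_nonneg σ), dotp]
  push_cast
  congr 2
  · simp only [Finset.mul_sum, Finset.sum_mul]
    exact Finset.sum_congr rfl fun i _ => by ring
  · simp only [Finset.mul_sum, Finset.sum_mul, Finset.sum_div]
    exact Finset.sum_congr rfl fun i _ => by ring

theorem gaussianReal_Iic_add_mul (m t : ℝ) {s : ℝ} (hs : 0 < s) :
    (gaussianReal m (s ^ 2).toNNReal (Set.Iic (m + s * t))).toReal = Phi t := by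
  have h : gaussianReal m (s ^ 2).toNNReal =
      ((gaussianReal 0 1).map (s * ·)).map (m + ·) := by
    rw [gaussianReal_map_const_mul, gaussianReal_map_const_add]
    simp [Real.toNNReal_of_nonneg (sq_nonneg s)]
  rw [h, Measure.map_map (by fun_prop) (by fun_prop), Measure.map_apply (by fun_prop)
    measurableSet_Iic, Phi]
  congr 2
  ext y
  simp [hs]

theorem gaussPi_halfspace {d : ℕ} (a m : Fin d → ℝ) {σ : ℝ} (hσ : 0 < σ) (ha : 0 < enorm2 d a)
    (t : ℝ) :
    (gaussPi d m σ {w | dotp d a w ≤ dotp d a m + σ * enorm2 d a * t}).toReal = Phi t := by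
  rw [← gaussianReal_Iic_add_mul (dotp d a m) t (mul_pos hσ ha), ← gaussPi_map_dotp,
    Measure.map_apply (by unfold dotp; fun_prop) measurableSet_Iic]
  rfl

theorem Phi_PhiInv {p : ℝ} (hp : p ∈ Set.Ioo (0 : ℝ) 1) : Phi (PhiInv p) = p := by
  have hcdf : Phi = cdf (gaussianReal 0 1) := by
    ext x
    rw [cdf_eq_real]
    rfl
  have := nullSingletonClass_gaussianReal (μ := 0) (v := 1) one_ne_zero
  have hcont : Continuous Phi := by
    rw [hcdf, continuous_iff_continuousAt]
    intro x
    have h0 : (cdf (gaussianReal 0 1)).measure {x} = 0 := by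
      rw [measure_cdf]
      exact measure_singleton x
    rw [StieltjesFunction.measure_singleton, ENNReal.ofReal_eq_zero] at h0
    rw [(monotone_cdf _).continuousAt_iff_leftLim_eq_rightLim, StieltjesFunction.rightLim_eq]
    exact le_antisymm ((monotone_cdf _).leftLim_le le_rfl) (by linarith)
  refine Function.invFun_eq (mem_range_of_exists_le_of_exists_ge hcont ?_ ?_)
  · rw [hcdf]
    exact ((tendsto_cdf_atBot (gaussianReal 0 1)).eventually_le_const hp.1).exists
  · rw [hcdf]
    exact ((tendsto_cdf_atTop (gaussianReal 0 1)).eventually_const_le hp.2).exists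

/-- The Neyman–Pearson lemma: among sets of at least a given measure, a sublevel set of the density
has the least weighted measure. -/
theorem withDensity_le_of_sublevel {α : Type*} [MeasurableSpace α] {μ : Measure α}
    [IsFiniteMeasure μ] {g : α → ℝ≥0∞} {k : ℝ≥0∞} {A B : Set α} (hA : MeasurableSet A)
    (hB : MeasurableSet B) (hle : ∀ w ∈ B, g w ≤ k) (hge : ∀ w ∉ B, k ≤ g w) (hμ : μ B ≤ μ A) :
    μ.withDensity g B ≤ μ.withDensity g A := by
  have hdiff : μ (B \ A) ≤ μ (A \ B) := by
    rw [← measure_inter_add_sdiff B hA, ← measure_inter_add_sdiff A hB, Set.inter_comm B A] at hμ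
    exact (ENNReal.add_le_add_iff_left (measure_ne_top μ _)).1 hμ
  rw [← measure_inter_add_sdiff B hA, ← measure_inter_add_sdiff A hB, Set.inter_comm B A]
  gcongr 1
  calc μ.withDensity g (B \ A)
      = ∫⁻ w in B \ A, g w ∂μ := withDensity_apply _ (hB.diff hA)
    _ ≤ ∫⁻ _ in B \ A, k ∂μ := setLIntegral_mono' (hB.diff hA) fun w hw => hle w hw.1
    _ = k * μ (B \ A) := setLIntegral_const _ _
    _ ≤ k * μ (A \ B) := by gcongr
    _ = ∫⁻ _ in A \ B, k ∂μ := (setLIntegral_const _ _).symm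
    _ ≤ ∫⁻ w in A \ B, g w ∂μ := setLIntegral_mono' (hA.diff hB) fun w hw => hge w hw.2
    _ = μ.withDensity g (A \ B) := (withDensity_apply _ (hA.diff hB)).symm

/-- Lower bound on the adversarial label probability of a single label `l`:
if `p̲_l ∈ (0,1)` satisfies `p̲_l ≤ Pr(l ∈ f_{k'}(X))` then
`Pr(l ∈ f_{k'}(Y)) ≥ Φ(Φ⁻¹(p̲_l) − ‖δ‖₂/σ)`, where `X ~ N(x,σ²I)`, `Y ~ N(x+δ,σ²I)`
and the base classifier `f` outputs exactly `k'` labels from `{1,…,c}`. -/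
theorem stmt10 {d : ℕ} (c k' : ℕ) (hk' : 1 ≤ k')
    (x δ : Fin d → ℝ) (hδ : δ ≠ 0) (σ : ℝ) (hσ : 0 < σ)
    (f : (Fin d → ℝ) → Finset (Fin c)) (hfcard : ∀ w, (f w).card = k')
    (hfm : ∀ i : Fin c, MeasurableSet {w : Fin d → ℝ | i ∈ f w})
    (l : Fin c) (plow : ℝ) (hmem : plow ∈ Set.Ioo (0 : ℝ) 1)
    (hle : plow ≤ ((gaussPi d x σ) {w | l ∈ f w}).toReal) :
    Phi (PhiInv plow - enorm2 d δ / σ) ≤ ((gaussPi d (x + δ) σ) {w | l ∈ f w}).toReal := by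
  obtain ⟨j, hj⟩ := Function.ne_iff.1 hδ
  have hpos : 0 < enorm2 d δ := Real.sqrt_pos.2 <|
    Finset.sum_pos' (fun i _ => sq_nonneg _) ⟨j, Finset.mem_univ j, sq_pos_of_ne_zero hj⟩
  have hdot : dotp d δ δ = enorm2 d δ ^ 2 := by
    rw [enorm2, Real.sq_sqrt (by positivity), dotp]
    exact Finset.sum_congr rfl fun i _ => (sq _).symm
  have hY := gaussPi_halfspace δ (x + δ) hσ hpos (PhiInv plow - enorm2 d δ / σ)
  have hthr : dotp d δ (x + δ) + σ * enorm2 d δ * (PhiInv plow - enorm2 d δ / σ) =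
      dotp d δ x + σ * enorm2 d δ * PhiInv plow := by
    have hadd : dotp d δ (x + δ) = dotp d δ x + dotp d δ δ := by
      simp [dotp, mul_add, Finset.sum_add_distrib]
    rw [hadd, hdot]
    field_simp
    ring
  rw [hthr] at hY
  have hX := gaussPi_halfspace δ x hσ hpos (PhiInv plow)
  rw [Phi_PhiInv hmem] at hX
  rw [← hX] at hle
  rw [← hY]
  refine ENNReal.toReal_mono (measure_ne_top _ _) ?_
  rw [gaussPi_add_eq_withDensity x δ hσ]
  refine withDensity_le_of_sublevel (k := ENNReal.ofReal (Real.exp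
    (σ * enorm2 d δ * PhiInv plow / σ ^ 2 - dotp d δ δ / (2 * σ ^ 2)))) (hfm l)
    (measurableSet_le (by unfold dotp; fun_prop) measurable_const) ?_ ?_
    ((ENNReal.toReal_le_toReal (measure_ne_top _ _) (measure_ne_top _ _)).1 hle)
  · intro w hw
    have hw' : dotp d δ w - dotp d δ x ≤ σ * enorm2 d δ * PhiInv plow :=
      sub_le_iff_le_add'.2 hw
    gcongr
  · intro w hw
    have hw' : σ * enorm2 d δ * PhiInv plow ≤ dotp d δ w - dotp d δ x :=
      le_sub_iff_add_le'.2 (not_le.1 hw).le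
    gcongr
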